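/- Let c, λ > 0 be real numbers, N a positive integer, and y > 0. Define I_{c,λ,N}(y) = (1/(2πi)) ∫_{c-i∞}^{c+i∞} y^s ((e^{λs}-1)/(λs))^N ds/s. Then I_{c,λ,N}(y) = 1 if y > 1, I_{c,λ,N}(y) ∈ [0,1] if e^{-λN} ≤ y ≤ 1, and I_{c,λ,N}(y) = 0 if 0 < y < e^{-λN}. -/

import Mathlib

open Complex Filter

lemma ne_zero_of_pos_re {c : ℝ} (hc : 0 < c) (t : ℝ) : (c : ℂ) + t * I ≠ 0 := by
  intro h
  have := congrArg re h
  simp at this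
  exact hc.ne' this

lemma le_norm_vertical {c : ℝ} (hc : 0 < c) (t : ℝ) : c ≤ ‖(c : ℂ) + t * I‖ := by
  simpa [abs_of_pos hc] using abs_re_le_norm ((c : ℂ) + t * I)

lemma continuous_vertical (c : ℝ) : Continuous fun t : ℝ => (c : ℂ) + t * I := by
  fun_prop

lemma integrable_one_div_sq_vertical {c : ℝ} (hc : 0 < c) :
    MeasureTheory.Integrable fun t : ℝ => 1 / ((c : ℂ) + t * I) ^ 2 := by
  have h := (integrable_inv_one_add_sq.comp_div hc.ne').const_mul (c ^ 2)⁻¹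
  refine h.mono' (Continuous.aestronglyMeasurable ?_) (.of_forall fun t => le_of_eq ?_)
  · exact continuous_const.div ((continuous_vertical c).pow 2)
      fun t => pow_ne_zero _ (ne_zero_of_pos_re hc t)
  · rw [norm_div, norm_one, norm_pow, Complex.sq_norm, normSq_add_mul_I, one_div, ← mul_inv]
    congr 1
    field_simp

/-- The Mellin transform of `x ↦ log x` restricted to `(0, 1]`. -/
lemma hasMellin_log_Ioc {s : ℂ} (hs : 0 < s.re) :
    HasMellin (fun x : ℝ => Real.log x • (Set.Ioc 0 1).indicator (fun _ => (1 : ℂ)) x) s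
      (-1 / s ^ 2) := by
  have hloc : MeasureTheory.LocallyIntegrableOn
      ((Set.Ioc (0 : ℝ) 1).indicator fun _ => (1 : ℂ)) (Set.Ioi 0) := by
    apply MeasureTheory.LocallyIntegrable.locallyIntegrableOn
    exact (MeasureTheory.locallyIntegrable_const 1).indicator measurableSet_Ioc
  have htop : ((Set.Ioc (0 : ℝ) 1).indicator fun _ => (1 : ℂ)) =O[atTop]
      (· ^ (-(s.re + 1))) := by
    refine Asymptotics.IsBigO.of_bound 1 ?_
    filter_upwards [eventually_gt_atTop 1] with x hx
    rw [Set.indicator_of_notMem (fun h => hx.not_ge h.2)]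
    simp
  have hbot : ((Set.Ioc (0 : ℝ) 1).indicator fun _ => (1 : ℂ)) =O[nhdsWithin 0 (Set.Ioi 0)]
      (· ^ (-(0 : ℝ))) := by
    refine Asymptotics.IsBigO.of_bound 1 (.of_forall fun x => ?_)
    simp only [neg_zero, Real.rpow_zero, norm_one, mul_one]
    exact (norm_indicator_le_norm_self _ _).trans (by simp)
  obtain ⟨hconv, hderiv⟩ :=
    mellin_hasDerivAt_of_isBigO_rpow hloc htop (by linarith) hbot hs
  refine ⟨hconv, hderiv.unique ?_⟩
  have hs0 : s ≠ 0 := by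
    rintro rfl
    simp at hs
  have hinv : HasDerivAt (fun z : ℂ => 1 / z) (-1 / s ^ 2) s := by
    simpa [one_div, neg_div] using hasDerivAt_inv hs0
  refine hinv.congr_of_eventuallyEq ?_
  filter_upwards [continuous_re.continuousAt.eventually (lt_mem_nhds hs)] with z hz
  exact (hasMellin_one_Ioc hz).2

/-- The ramp function as an inverse Laplace transform. -/
lemma integral_exp_mul_div_sq {c : ℝ} (hc : 0 < c) (x : ℝ) :
    (1 / (2 * Real.pi) : ℂ) * ∫ t : ℝ, exp (x * (c + t * I)) / ((c : ℂ) + t * I) ^ 2 =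
      (max x 0 : ℝ) := by
  set f : ℝ → ℂ := fun x => Real.log x • (Set.Ioc 0 1).indicator (fun _ => (1 : ℂ)) x with hf
  have hmel (t : ℝ) : mellin f (c + t * I) = -(1 / ((c : ℂ) + t * I) ^ 2) := by
    rw [(hasMellin_log_Ioc (by simpa using hc)).2, neg_div]
  have hfmin : ∀ᶠ z in nhds (Real.exp (-x)), f z = (min (Real.log z) 0 : ℝ) := by
    filter_upwards [lt_mem_nhds (Real.exp_pos (-x))] with z hz
    by_cases h : z ≤ 1
    · simp [hf, hz, h, min_eq_left (Real.log_nonpos hz.le h)]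
    · simp [hf, h, min_eq_right (Real.log_nonneg (not_le.1 h).le)]
  have hcont : ContinuousAt f (Real.exp (-x)) := by
    refine ContinuousAt.congr ?_ (hfmin.mono fun _ h => h.symm)
    have := Real.continuousAt_log (Real.exp_ne_zero (-x))
    fun_prop
  have hinv := mellinInv_mellin_eq c f (Real.exp_pos (-x))
    (hasMellin_log_Ioc (by simpa using hc)).1
    (by
      simp only [VerticalIntegrable, hmel]
      exact (integrable_one_div_sq_vertical hc).neg) hcont
  rw [hfmin.self_of_nhds, mellinInv] at hinv
  have hint (t : ℝ) : ((Real.exp (-x) : ℝ) : ℂ) ^ (-((c : ℂ) + t * I)) • mellin f (c + t * I) =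
      -(exp (x * (c + t * I)) / ((c : ℂ) + t * I) ^ 2) := by
    rw [hmel, ofReal_exp, cpow_def_of_ne_zero (exp_ne_zero _), ← ofReal_exp, ← ofReal_log
      (Real.exp_pos _).le, Real.log_exp, smul_eq_mul]
    push_cast
    rw [neg_mul_neg]
    ring
  simp only [hint, MeasureTheory.integral_neg, real_smul, Real.log_exp, mul_neg] at hinv
  push_cast at hinv
  rw [← neg_inj, hinv, ← ofReal_neg, ← min_neg_neg, neg_zero]

/-- The integrand of the smoothed Perron formula, in the variable `x = log y`. -/
noncomputable def perronKernel (lam : ℝ) (N : ℕ) (x : ℝ) (s : ℂ) : ℂ :=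
  exp (x * s) * ((exp (lam * s) - 1) / (lam * s)) ^ N / s

/-- The integral of the smoothed Perron formula, in the variable `x = log y`. -/
noncomputable def perronWeight (c lam : ℝ) (N : ℕ) (x : ℝ) : ℂ :=
  (1 / (2 * Real.pi) : ℂ) * ∫ t : ℝ, perronKernel lam N x (c + t * I)

lemma norm_exp_mul_vertical (c x t : ℝ) :
    ‖exp (x * ((c : ℂ) + t * I))‖ = Real.exp (x * c) := by
  simp [norm_exp]

lemma norm_smoothing_le {c lam : ℝ} (hc : 0 < c) (hlam : 0 < lam) (t : ℝ) :
    ‖(exp (lam * ((c : ℂ) + t * I)) - 1) / (lam * ((c : ℂ) + t * I))‖ ≤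
      (Real.exp (lam * c) + 1) / (lam * c) := by
  rw [norm_div, norm_mul, norm_real, Real.norm_of_nonneg hlam.le]
  gcongr
  · exact (norm_sub_le _ _).trans (by rw [norm_exp_mul_vertical, norm_one])
  · exact le_norm_vertical hc t

lemma integrable_perronKernel {c lam : ℝ} (hc : 0 < c) (hlam : 0 < lam) {N : ℕ} (hN : 1 ≤ N)
    (x : ℝ) : MeasureTheory.Integrable fun t : ℝ => perronKernel lam N x (c + t * I) := by
  obtain ⟨M, rfl⟩ := Nat.exists_eq_add_of_le' hN
  have hlam' : (lam : ℂ) ≠ 0 := by exact_mod_cast hlam.ne'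
  have hcont : Continuous fun t : ℝ => exp (x * ((c : ℂ) + t * I)) *
      ((exp (lam * ((c : ℂ) + t * I)) - 1) / (lam * ((c : ℂ) + t * I))) ^ M *
      ((exp (lam * ((c : ℂ) + t * I)) - 1) / lam) := by
    have := fun t => mul_ne_zero hlam' (ne_zero_of_pos_re hc t)
    fun_prop (disch := assumption)
  refine ((integrable_one_div_sq_vertical hc).bdd_mul
    (c := Real.exp (x * c) * ((Real.exp (lam * c) + 1) / (lam * c)) ^ M *
      ((Real.exp (lam * c) + 1) / lam)) hcont.aestronglyMeasurable
    (.of_forall fun t => ?_)).congr (.of_forall fun t => ?_)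
  · rw [norm_mul, norm_mul, norm_pow, norm_exp_mul_vertical]
    gcongr
    · exact norm_smoothing_le hc hlam t
    · rw [norm_div, norm_real, Real.norm_of_nonneg hlam.le]
      gcongr
      exact (norm_sub_le _ _).trans (by rw [norm_exp_mul_vertical, norm_one])
  · have := ne_zero_of_pos_re hc t
    simp only [perronKernel, pow_succ]
    field_simp

lemma perronWeight_one {c lam : ℝ} (hc : 0 < c) (hlam : 0 < lam) (x : ℝ) :
    perronWeight c lam 1 x = ((max (x + lam) 0 - max x 0) / lam : ℝ) := by
  have hlam' : (lam : ℂ) ≠ 0 := by exact_mod_cast hlam.ne'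
  have hint (x : ℝ) : MeasureTheory.Integrable
      fun t : ℝ => exp (x * (c + t * I)) / ((c : ℂ) + t * I) ^ 2 := by
    refine ((integrable_one_div_sq_vertical hc).bdd_mul (c := Real.exp (x * c))
      (f := fun t : ℝ => exp (x * (c + t * I)))
      (Continuous.aestronglyMeasurable (by fun_prop))
      (.of_forall fun t => (norm_exp_mul_vertical c x t).le)).congr (.of_forall fun t => ?_)
    simp [div_eq_mul_inv]
  have hker (t : ℝ) : perronKernel lam 1 x (c + t * I) =
      (exp ((x + lam : ℝ) * (c + t * I)) / ((c : ℂ) + t * I) ^ 2 -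
        exp (x * (c + t * I)) / ((c : ℂ) + t * I) ^ 2) / lam := by
    have := ne_zero_of_pos_re hc t
    rw [perronKernel, ofReal_add, add_mul, exp_add]
    field_simp
  simp only [perronWeight, hker]
  rw [MeasureTheory.integral_div, MeasureTheory.integral_sub (hint _) (hint _), ofReal_div,
    ofReal_sub, ← integral_exp_mul_div_sq hc, ← integral_exp_mul_div_sq hc]
  ring

/-- Each smoothing factor averages the weight over an interval of length `lam`. -/
lemma perronWeight_succ {c lam : ℝ} (hc : 0 < c) (hlam : 0 < lam) {N : ℕ} (hN : 1 ≤ N) (x : ℝ) :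
    perronWeight c lam (N + 1) x = ∫ u in (0 : ℝ)..1, perronWeight c lam N (x + lam * u) := by
  have hker (t u : ℝ) : perronKernel lam N (x + lam * u : ℝ) (c + t * I) =
      exp (lam * ((c : ℂ) + t * I) * u) * perronKernel lam N x (c + t * I) := by
    rw [perronKernel, perronKernel, ofReal_add, ofReal_mul, add_mul, exp_add,
      mul_right_comm (lam : ℂ)]
    ring
  have : MeasureTheory.IsFiniteMeasure (MeasureTheory.volume.restrict (Set.uIoc (0 : ℝ) 1)) := by
    rw [Set.uIoc_of_le zero_le_one]
    infer_instance
  have hint : MeasureTheory.Integrable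
      (Function.uncurry fun u t : ℝ => perronKernel lam N (x + lam * u : ℝ) (c + t * I))
      ((MeasureTheory.volume.restrict (Set.uIoc 0 1)).prod MeasureTheory.volume) := by
    simp only [Function.uncurry_def, hker]
    refine ((integrable_perronKernel hc hlam hN x).comp_snd _).bdd_mul
      (c := Real.exp (lam * c)) (Continuous.aestronglyMeasurable (by fun_prop)) ?_
    have hmem : ∀ᵐ p : ℝ × ℝ ∂((MeasureTheory.volume.restrict (Set.uIoc 0 1)).prod
        MeasureTheory.volume), p.1 ∈ Set.uIoc (0 : ℝ) 1 :=
      MeasureTheory.Measure.quasiMeasurePreserving_fst.ae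
        (MeasureTheory.ae_restrict_mem measurableSet_uIoc)
    filter_upwards [hmem] with p hp
    rw [Set.uIoc_of_le zero_le_one] at hp
    rw [norm_exp]
    simp only [mul_re, add_re, ofReal_re, ofReal_im, I_re, I_im, mul_im, add_im]
    gcongr
    nlinarith [mul_pos hlam hc, hp.2]
  simp only [perronWeight]
  rw [intervalIntegral.integral_const_mul, MeasureTheory.intervalIntegral_integral_swap hint]
  congr 2 with t
  have h0 : (lam : ℂ) * (c + t * I) ≠ 0 :=
    mul_ne_zero (by exact_mod_cast hlam.ne') (ne_zero_of_pos_re hc t)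
  simp only [hker]
  rw [intervalIntegral.integral_mul_const, integral_exp_mul_complex h0]
  simp only [perronKernel, ofReal_one, ofReal_zero, mul_one, mul_zero, exp_zero]
  ring

lemma exists_perronWeight_eq {c lam : ℝ} (hc : 0 < c) (hlam : 0 < lam) {N : ℕ} (hN : 1 ≤ N) :
    ∃ w : ℝ → ℝ, Continuous w ∧ (∀ x, perronWeight c lam N x = w x) ∧
      (∀ x, w x ∈ Set.Icc 0 1) ∧ (∀ x, 0 < x → w x = 1) ∧ (∀ x, x < -(lam * N) → w x = 0) := by
  induction N, hN using Nat.le_induction with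
  | base =>
    refine ⟨_, ?_, perronWeight_one hc hlam, fun x => ⟨?_, ?_⟩, fun x hx => ?_, fun x hx => ?_⟩
    · fun_prop
    · exact div_nonneg (sub_nonneg.2 (max_le_max_right 0 (by linarith))) hlam.le
    · rw [div_le_one hlam, sub_le_iff_le_add]
      exact max_le (by linarith [le_max_left x 0]) (by linarith [le_max_right x 0])
    · rw [max_eq_left (by linarith), max_eq_left hx.le]
      field_simp
      ring
    · rw [Nat.cast_one, mul_one] at hx
      rw [max_eq_right (by linarith), max_eq_right (by linarith)]
      simp
  | succ N hN ih =>
    obtain ⟨w, hcont, hw, hmem, hone, hzero⟩ := ih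
    have hi (x : ℝ) : IntervalIntegrable (fun u => w (x + lam * u)) MeasureTheory.volume 0 1 :=
      Continuous.intervalIntegrable (by fun_prop) _ _
    refine ⟨fun x => ∫ u in (0 : ℝ)..1, w (x + lam * u), ?_, fun x => ?_, fun x => ⟨?_, ?_⟩,
      fun x hx => ?_, fun x hx => ?_⟩
    · exact intervalIntegral.continuous_parametric_intervalIntegral_of_continuous'
        (by fun_prop) 0 1
    · simp only [perronWeight_succ hc hlam hN, hw, intervalIntegral.integral_ofReal]
    · exact intervalIntegral.integral_nonneg zero_le_one fun u _ => (hmem _).1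
    · simpa using intervalIntegral.integral_mono_on zero_le_one (hi x)
        (intervalIntegrable_const (c := (1 : ℝ))) fun u _ => (hmem _).2
    · have : Set.EqOn (fun u => w (x + lam * u)) (fun _ => 1) (Set.uIcc 0 1) := fun u hu => by
        rw [Set.uIcc_of_le zero_le_one] at hu
        exact hone _ (by nlinarith [hu.1])
      simp [intervalIntegral.integral_congr this]
    · have : Set.EqOn (fun u => w (x + lam * u)) (fun _ => 0) (Set.uIcc 0 1) := fun u hu => by
        rw [Set.uIcc_of_le zero_le_one] at hu
        push_cast at hx
        exact hzero _ (by nlinarith [hu.2])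
      simp [intervalIntegral.integral_congr this]

/-- Smoothed Perron formula: for `c, λ > 0`, `N ≥ 1` and `y > 0`, the integral
`I_{c,λ,N}(y) = (1/(2πi)) ∫_{c-i∞}^{c+i∞} y^s ((e^{λs}-1)/(λs))^N ds/s`
(a symmetric limit along the vertical line `Re s = c`) exists, is real,
equals `1` for `y > 1`, lies in `[0,1]` for `e^{-λN} ≤ y ≤ 1`, and equals
`0` for `0 < y < e^{-λN}`. -/
theorem smoothed_perron (c lam : ℝ) (hc : 0 < c) (hlam : 0 < lam)
    (N : ℕ) (hN : 0 < N) (y : ℝ) (hy : 0 < y) :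
    ∃ v : ℝ,
      Tendsto (fun T : ℝ =>
        (1 / (2 * Real.pi * I)) *
          ∫ t in (-T)..T,
            (y : ℂ) ^ ((c : ℂ) + t * I) *
              ((Complex.exp ((lam : ℂ) * ((c : ℂ) + t * I)) - 1) /
                ((lam : ℂ) * ((c : ℂ) + t * I))) ^ N /
              ((c : ℂ) + t * I) * I)
        atTop (nhds (v : ℂ)) ∧
      (1 < y → v = 1) ∧
      (Real.exp (-(lam * N)) ≤ y → y ≤ 1 → 0 ≤ v ∧ v ≤ 1) ∧
      (y < Real.exp (-(lam * N)) → v = 0) := by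
  obtain ⟨w, -, hw, hmem, hone, hzero⟩ := exists_perronWeight_eq hc hlam hN
  refine ⟨w (Real.log y), ?_, fun h => hone _ (Real.log_pos h), fun _ _ => hmem _,
    fun h => hzero _ ?_⟩
  · rw [← hw, perronWeight]
    have hlim := (MeasureTheory.intervalIntegral_tendsto_integral
      (integrable_perronKernel hc hlam hN (Real.log y)) tendsto_neg_atTop_atBot
      tendsto_id).const_mul (1 / (2 * Real.pi) : ℂ)
    refine hlim.congr fun T => ?_
    have hker (t : ℝ) : (y : ℂ) ^ ((c : ℂ) + t * I) *
        ((exp ((lam : ℂ) * ((c : ℂ) + t * I)) - 1) / ((lam : ℂ) * ((c : ℂ) + t * I))) ^ N /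
          ((c : ℂ) + t * I) = perronKernel lam N (Real.log y) (c + t * I) := by
      rw [perronKernel, cpow_def_of_ne_zero (by exact_mod_cast hy.ne'), ← ofReal_log hy.le]
    simp only [hker, intervalIntegral.integral_mul_const, id_eq]
    generalize (∫ t in (-T)..T, perronKernel lam N (Real.log y) (c + t * I)) = J
    field_simp
  · rwa [← Real.log_exp (-(lam * N)), Real.log_lt_log_iff hy (Real.exp_pos _)]
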